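/- The truncation operation is monotone: if N and N⁺ are utilization vectors with N ≤ N⁺ componentwise, then N^(2) ≤ N^{+(2)} componentwise. -/

import Mathlib

open Finset
open scoped Classical

noncomputable section

namespace IK

variable {ι : Type*} [Fintype ι]

/-- `Wcl wgt ℓ a b = Σ_{j=a}^{b} w_{ℓ,j}`, the total weight of items `a,…,b` of class `ℓ`. -/
def Wcl (wgt : ι → ℕ → ℝ) (ℓ : ι) (a b : ℕ) : ℝ := ∑ j ∈ Finset.Icc a b, wgt ℓ j

/-- The set `H(N)` of classes that are heavy for `N` (here `e = 1/ε`). -/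
def heavy (e : ℕ) (N : ι → ℕ) : Finset ι := Finset.univ.filter fun ℓ => e < N ℓ

/-- `W_H(N)`, the weight picked by `N` from heavy classes beyond their first `1/ε` items. -/
def WH (wgt : ι → ℕ → ℝ) (e : ℕ) (N : ι → ℕ) : ℝ :=
  ∑ ℓ ∈ heavy e N, Wcl wgt ℓ (e + 1) (N ℓ)

/-- `P2[x]`: the least integer power of `2` that is `≥ x` for `x > 0`, and `0` for `x ≤ 0`. -/
def P2 (x : ℝ) : ℝ := if 0 < x then (2 : ℝ) ^ ⌈Real.logb 2 x⌉ else 0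

/-- The rounding unit `P2[(ε/|L|)·W_H(N)]`. -/
def base (ε : ℝ) (wgt : ι → ℕ → ℝ) (e : ℕ) (N : ι → ℕ) : ℝ :=
  P2 (ε / (Fintype.card ι) * WH wgt e N)

/-- The multiplier `μ_ℓ(N)`: the unique integer with
`(μ_ℓ(N)−1)·P2[(ε/|L|)·W_H(N)] < W_ℓ(1/ε+1, N_ℓ) ≤ μ_ℓ(N)·P2[(ε/|L|)·W_H(N)]`. -/
def mu (ε : ℝ) (wgt : ι → ℕ → ℝ) (e : ℕ) (N : ι → ℕ) (ℓ : ι) : ℤ :=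
  ⌈Wcl wgt ℓ (e + 1) (N ℓ) / base ε wgt e N⌉

/-- The over-estimate `E_ℓ(N) = μ_ℓ(N)·P2[(ε/|L|)·W_H(N)]`. -/
def Ecl (ε : ℝ) (wgt : ι → ℕ → ℝ) (e : ℕ) (N : ι → ℕ) (ℓ : ι) : ℝ :=
  (mu ε wgt e N ℓ : ℝ) * base ε wgt e N

/-- The up-rounding `N^(1)` of `N`: coordinates of light classes are kept, while each heavy
class picks `max{k ∈ [1/ε+1, n_ℓ] : W_ℓ(1/ε+1, k) ≤ E_ℓ(N)}` items. -/
def upround (ε : ℝ) (wgt : ι → ℕ → ℝ) (nI : ι → ℕ) (e : ℕ) (N : ι → ℕ) : ι → ℕ :=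
  fun ℓ =>
    if e < N ℓ then
      ((Finset.Icc (e + 1) (nI ℓ)).filter fun k => Wcl wgt ℓ (e + 1) k ≤ Ecl ε wgt e N ℓ).sup id
    else N ℓ

/-- `Δ_ℓ(N) = N^(1)_ℓ − 1/ε`. -/
def delta (ε : ℝ) (wgt : ι → ℕ → ℝ) (nI : ι → ℕ) (e : ℕ) (N : ι → ℕ) (ℓ : ι) : ℕ :=
  upround ε wgt nI e N ℓ - e

/-- The truncation `N^(2)` of `N`: coordinates of light classes are kept, while each heavy
class eliminates its last `⌈2ε·Δ_ℓ(N)⌉` items from `N^(1)`. -/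
def trunc (ε : ℝ) (wgt : ι → ℕ → ℝ) (nI : ι → ℕ) (e : ℕ) (N : ι → ℕ) : ι → ℕ :=
  fun ℓ =>
    if e < N ℓ then
      upround ε wgt nI e N ℓ - (⌈2 * ε * (delta ε wgt nI e N ℓ : ℝ)⌉).toNat
    else upround ε wgt nI e N ℓ

/-- The total weight `w(N) = Σ_ℓ W_ℓ(1, N_ℓ)` of a utilization vector. -/
def wtot (wgt : ι → ℕ → ℝ) (N : ι → ℕ) : ℝ := ∑ ℓ : ι, Wcl wgt ℓ 1 (N ℓ)

end IK

namespace IK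

theorem P2_pos {x : ℝ} (hx : 0 < x) : 0 < P2 x := by
  rw [P2, if_pos hx]
  positivity

theorem exists_P2_eq_mul {x y : ℝ} (hx : 0 < x) (hxy : x ≤ y) :
    ∃ m : ℤ, P2 y = m * P2 x := by
  have hlog : ⌈Real.logb 2 x⌉ ≤ ⌈Real.logb 2 y⌉ :=
    Int.ceil_mono (Real.logb_le_logb_of_le one_lt_two hx hxy)
  obtain ⟨d, hd⟩ := Int.le.dest hlog
  refine ⟨2 ^ d, ?_⟩
  rw [P2, P2, if_pos hx, if_pos (hx.trans_le hxy), ← hd, zpow_add₀ two_ne_zero, zpow_natCast]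
  push_cast
  ring

theorem le_ceil_div_mul {b : ℝ} (hb : 0 < b) (w : ℝ) : w ≤ (⌈w / b⌉ : ℝ) * b :=
  (div_le_iff₀ hb).1 (Int.le_ceil _)

theorem ceil_div_mul_le_ceil_div_mul {b c w v : ℝ} (hb : 0 < b) (hc : 0 < c)
    (hbc : ∃ m : ℤ, c = m * b) (hwv : w ≤ v) :
    (⌈w / b⌉ : ℝ) * b ≤ (⌈v / c⌉ : ℝ) * c := by
  obtain ⟨m, rfl⟩ := hbc
  have hle : ⌈w / b⌉ ≤ ⌈v / (m * b)⌉ * m := by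
    rw [Int.ceil_le, div_le_iff₀ hb]
    push_cast
    rw [mul_assoc]
    exact hwv.trans (le_ceil_div_mul hc v)
  have hle' : (⌈w / b⌉ : ℝ) ≤ (⌈v / (m * b)⌉ : ℝ) * m := mod_cast hle
  rw [← mul_assoc]
  exact mul_le_mul_of_nonneg_right hle' hb.le

theorem ceil_mul_le_add {a : ℝ} (ha : a ≤ 1) {x y : ℕ} (hxy : x ≤ y) :
    ⌈a * (y : ℝ)⌉ ≤ ⌈a * (x : ℝ)⌉ + ((y : ℤ) - x) := by
  rw [Int.ceil_le]
  push_cast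
  have hxy' : (x : ℝ) ≤ y := mod_cast hxy
  nlinarith [Int.le_ceil (a * (x : ℝ))]

theorem sub_toNat_ceil_mono {a : ℝ} (ha : a ≤ 1) {e u v : ℕ} (hu : e ≤ u) (huv : u ≤ v) :
    u - ⌈a * ((u - e : ℕ) : ℝ)⌉.toNat ≤ v - ⌈a * ((v - e : ℕ) : ℝ)⌉.toNat := by
  have h := ceil_mul_le_add ha (Nat.sub_le_sub_right huv e)
  have h0 := ceil_mul_le_add ha (Nat.zero_le (u - e))
  simp only [Nat.cast_zero, mul_zero, Int.ceil_zero] at h0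
  omega

variable {ι : Type*}

theorem Wcl_mono {nI : ι → ℕ} {wgt : ι → ℕ → ℝ}
    (hw0 : ∀ ℓ, ∀ j ∈ Finset.Icc 1 (nI ℓ), 0 < wgt ℓ j) {ℓ : ι} {e a b : ℕ}
    (hab : a ≤ b) (hb : b ≤ nI ℓ) : Wcl wgt ℓ (e + 1) a ≤ Wcl wgt ℓ (e + 1) b := by
  refine Finset.sum_le_sum_of_subset_of_nonneg (Finset.Icc_subset_Icc_right hab) ?_
  intro j hj _
  rw [Finset.mem_Icc] at hj
  exact (hw0 ℓ j (Finset.mem_Icc.2 ⟨by omega, hj.2.trans hb⟩)).le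

theorem Wcl_pos {nI : ι → ℕ} {wgt : ι → ℕ → ℝ}
    (hw0 : ∀ ℓ, ∀ j ∈ Finset.Icc 1 (nI ℓ), 0 < wgt ℓ j) {ℓ : ι} {e b : ℕ}
    (heb : e < b) (hb : b ≤ nI ℓ) : 0 < Wcl wgt ℓ (e + 1) b := by
  refine Finset.sum_pos ?_ ⟨b, Finset.mem_Icc.2 ⟨heb, le_rfl⟩⟩
  intro j hj
  rw [Finset.mem_Icc] at hj
  exact hw0 ℓ j (Finset.mem_Icc.2 ⟨by omega, hj.2.trans hb⟩)

variable [Fintype ι]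

theorem mem_heavy {e : ℕ} {N : ι → ℕ} {ℓ : ι} : ℓ ∈ heavy e N ↔ e < N ℓ := by
  simp [heavy]

theorem WH_pos {nI : ι → ℕ} {wgt : ι → ℕ → ℝ}
    (hw0 : ∀ ℓ, ∀ j ∈ Finset.Icc 1 (nI ℓ), 0 < wgt ℓ j) {e : ℕ} {N : ι → ℕ}
    (hN : ∀ ℓ, N ℓ ≤ nI ℓ) {ℓ : ι} (hℓ : e < N ℓ) : 0 < WH wgt e N :=
  Finset.sum_pos (fun k hk => Wcl_pos hw0 (mem_heavy.1 hk) (hN k)) ⟨ℓ, mem_heavy.2 hℓ⟩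

theorem WH_mono {nI : ι → ℕ} {wgt : ι → ℕ → ℝ}
    (hw0 : ∀ ℓ, ∀ j ∈ Finset.Icc 1 (nI ℓ), 0 < wgt ℓ j) {e : ℕ} {N M : ι → ℕ}
    (hM : ∀ ℓ, M ℓ ≤ nI ℓ) (hNM : ∀ ℓ, N ℓ ≤ M ℓ) : WH wgt e N ≤ WH wgt e M := by
  calc WH wgt e N
      ≤ ∑ ℓ ∈ heavy e N, Wcl wgt ℓ (e + 1) (M ℓ) :=
        Finset.sum_le_sum fun ℓ _ => Wcl_mono hw0 (hNM ℓ) (hM ℓ)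
    _ ≤ WH wgt e M := by
        refine Finset.sum_le_sum_of_subset_of_nonneg ?_ ?_
        · exact fun ℓ hℓ => mem_heavy.2 ((mem_heavy.1 hℓ).trans_le (hNM ℓ))
        · exact fun ℓ hℓ _ => (Wcl_pos hw0 (mem_heavy.1 hℓ) (hM ℓ)).le

theorem base_pos {ε : ℝ} (hε : 0 < ε) {nI : ι → ℕ} {wgt : ι → ℕ → ℝ}
    (hw0 : ∀ ℓ, ∀ j ∈ Finset.Icc 1 (nI ℓ), 0 < wgt ℓ j) {e : ℕ} {N : ι → ℕ}
    (hN : ∀ ℓ, N ℓ ≤ nI ℓ) {ℓ : ι} (hℓ : e < N ℓ) : 0 < base ε wgt e N := by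
  have : Nonempty ι := ⟨ℓ⟩
  have hcard : (0 : ℝ) < Fintype.card ι := mod_cast Fintype.card_pos
  exact P2_pos (mul_pos (div_pos hε hcard) (WH_pos hw0 hN hℓ))

theorem Ecl_mono {ε : ℝ} (hε : 0 < ε) {nI : ι → ℕ} {wgt : ι → ℕ → ℝ}
    (hw0 : ∀ ℓ, ∀ j ∈ Finset.Icc 1 (nI ℓ), 0 < wgt ℓ j) {e : ℕ} {N M : ι → ℕ}
    (hM : ∀ ℓ, M ℓ ≤ nI ℓ) (hNM : ∀ ℓ, N ℓ ≤ M ℓ) {ℓ : ι} (hℓ : e < N ℓ) :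
    Ecl ε wgt e N ℓ ≤ Ecl ε wgt e M ℓ := by
  have : Nonempty ι := ⟨ℓ⟩
  have hcard : (0 : ℝ) < Fintype.card ι := mod_cast Fintype.card_pos
  have hN : ∀ ℓ, N ℓ ≤ nI ℓ := fun k => (hNM k).trans (hM k)
  refine ceil_div_mul_le_ceil_div_mul (base_pos hε hw0 hN hℓ)
    (base_pos hε hw0 hM (hℓ.trans_le (hNM ℓ))) ?_ (Wcl_mono hw0 (hNM ℓ) (hM ℓ))
  exact exists_P2_eq_mul (mul_pos (div_pos hε hcard) (WH_pos hw0 hN hℓ))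
    (mul_le_mul_of_nonneg_left (WH_mono hw0 hM hNM) (div_pos hε hcard).le)

theorem le_upround {ε : ℝ} (hε : 0 < ε) {nI : ι → ℕ} {wgt : ι → ℕ → ℝ}
    (hw0 : ∀ ℓ, ∀ j ∈ Finset.Icc 1 (nI ℓ), 0 < wgt ℓ j) {e : ℕ} {N : ι → ℕ}
    (hN : ∀ ℓ, N ℓ ≤ nI ℓ) (ℓ : ι) : N ℓ ≤ upround ε wgt nI e N ℓ := by
  unfold upround
  split_ifs with hℓ
  · refine Finset.le_sup (f := id) (Finset.mem_filter.2 ⟨Finset.mem_Icc.2 ⟨hℓ, hN ℓ⟩, ?_⟩)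
    exact le_ceil_div_mul (base_pos hε hw0 hN hℓ) _
  · exact le_rfl

theorem upround_mono {ε : ℝ} (hε : 0 < ε) {nI : ι → ℕ} {wgt : ι → ℕ → ℝ}
    (hw0 : ∀ ℓ, ∀ j ∈ Finset.Icc 1 (nI ℓ), 0 < wgt ℓ j) {e : ℕ} {N M : ι → ℕ}
    (hM : ∀ ℓ, M ℓ ≤ nI ℓ) (hNM : ∀ ℓ, N ℓ ≤ M ℓ) (ℓ : ι) :
    upround ε wgt nI e N ℓ ≤ upround ε wgt nI e M ℓ := by
  by_cases hℓ : e < N ℓ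
  · unfold upround
    rw [if_pos hℓ, if_pos (hℓ.trans_le (hNM ℓ))]
    refine Finset.sup_mono (Finset.monotone_filter_right _ fun k _ hk => ?_)
    exact le_trans hk (Ecl_mono hε hw0 hM hNM hℓ)
  · calc upround ε wgt nI e N ℓ = N ℓ := if_neg hℓ
      _ ≤ M ℓ := hNM ℓ
      _ ≤ upround ε wgt nI e M ℓ := le_upround hε hw0 hM ℓ

end IK

/-- The truncation operation is monotone: if `N ≤ N⁺` componentwise then
`N^(2) ≤ N^{+(2)}` componentwise. -/
theorem stmt6 {ι : Type*} [Fintype ι] [Nonempty ι]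
    (ε : ℝ) (e : ℕ) (hε0 : 0 < ε) (hε : ε < 1 / 4) (he : (e : ℝ) * ε = 1)
    (nI : ι → ℕ) (wgt : ι → ℕ → ℝ)
    (hw0 : ∀ ℓ, ∀ j ∈ Finset.Icc 1 (nI ℓ), 0 < wgt ℓ j)
    (hwm : ∀ ℓ, ∀ j k : ℕ, 1 ≤ j → j ≤ k → k ≤ nI ℓ → wgt ℓ j ≤ wgt ℓ k)
    (N Np : ι → ℕ) (hN : ∀ ℓ, N ℓ ≤ nI ℓ) (hNp : ∀ ℓ, Np ℓ ≤ nI ℓ)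
    (hle : ∀ ℓ, N ℓ ≤ Np ℓ) :
    ∀ ℓ, IK.trunc ε wgt nI e N ℓ ≤ IK.trunc ε wgt nI e Np ℓ := by
  intro ℓ
  have ha : 2 * ε ≤ 1 := by linarith
  have hmono := IK.upround_mono hε0 hw0 (e := e) hNp hle ℓ
  have hupN := IK.le_upround hε0 hw0 (e := e) hN ℓ
  have hupNp := IK.le_upround hε0 hw0 (e := e) hNp ℓ
  unfold IK.trunc IK.delta
  by_cases hℓ : e < N ℓ
  · rw [if_pos hℓ, if_pos (hℓ.trans_le (hle ℓ))]
    exact IK.sub_toNat_ceil_mono ha (hℓ.le.trans hupN) hmono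
  · rw [if_neg hℓ]
    split_ifs with hp
    · have hlight : IK.upround ε wgt nI e N ℓ = N ℓ := if_neg hℓ
      have h := IK.sub_toNat_ceil_mono ha (le_refl e) (hp.le.trans hupNp)
      simp only [Nat.sub_self, Nat.cast_zero, mul_zero, Int.ceil_zero, Int.toNat_zero,
        Nat.sub_zero] at h
      exact (hlight.trans_le (not_lt.1 hℓ)).trans h
    · exact hmono
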